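/- Let m ≥ n ≥ 1 be integers and let i, i' be nonnegative integers with 2i ≤ m − n + 1 and 2i' ≤ m − n + 1. Define the fold normal form g_i : ℝ^m → ℝ^n by g_i(x₁,…,x_m) = (x₁,…,x_{n−1}, Σ_{k=n}^{m−i} x_k² − Σ_{k=m−i+1}^{m} x_k²), and similarly g_{i'}. Suppose there exist open neighborhoods U ⊆ ℝ^m and V ⊆ ℝ^n of the respective origins, and smooth maps φ : U → ℝ^m and ψ : V → ℝ^n, each a diffeomorphism onto an open image (i.e., smooth, injective, open, with smooth inverse on the image), with φ(0) = 0, ψ(0) = 0, g_i(U) ⊆ V, and ψ ∘ g_i = g_{i'} ∘ φ on U. Then i = i'. (This is the uniqueness of the index of a singular point of a fold map, expressed in local coordinates.) -/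

import Mathlib

open Finset in
/-- The fold normal form `g_i : ℝ^m → ℝ^n` (written in 0-based coordinates):
`g_i (x₀, …, x_{m-1}) = (x₀, …, x_{n-2}, ∑_{k=n-1}^{m-i-1} x_k² − ∑_{k=m-i}^{m-1} x_k²)`,
which in the 1-based notation of the paper is
`g_i (x₁, …, x_m) = (x₁, …, x_{n-1}, ∑_{k=n}^{m-i} x_k² − ∑_{k=m-i+1}^{m} x_k²)`. -/
def foldMap (m n : ℕ) (hmn : n ≤ m) (i : ℕ) (x : Fin m → ℝ) : Fin n → ℝ :=
  fun j =>
    if (j : ℕ) < n - 1 then x (Fin.castLE hmn j)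
    else (∑ k : Fin m, if n - 1 ≤ (k : ℕ) ∧ (k : ℕ) < m - i then x k ^ 2 else 0)
      - ∑ k : Fin m, if m - i ≤ (k : ℕ) then x k ^ 2 else 0

/-- Last coordinate of the fold map. -/
def foldQ (m n i : ℕ) (x : Fin m → ℝ) : ℝ :=
  (∑ k : Fin m, if n - 1 ≤ (k : ℕ) ∧ (k : ℕ) < m - i then x k ^ 2 else 0)
      - ∑ k : Fin m, if m - i ≤ (k : ℕ) then x k ^ 2 else 0

lemma foldQ_smul (m n i : ℕ) (t : ℝ) (x : Fin m → ℝ) :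
    foldQ m n i (t • x) = t ^ 2 * foldQ m n i x := by
  simp only [foldQ, mul_sub, Finset.mul_sum, Pi.smul_apply, smul_eq_mul, mul_pow, mul_ite, mul_zero]

lemma foldQ_continuous (m n i : ℕ) : Continuous (foldQ m n i) := by
  unfold foldQ
  refine Continuous.sub ?_ ?_ <;> refine continuous_finsetSum _ fun k _ => ?_
  all_goals split_ifs <;> fun_prop

lemma foldQ_pos (m n i : ℕ) (x : Fin m → ℝ) (hx : x ≠ 0)
    (h : ∀ k : Fin m, ¬ (n - 1 ≤ (k : ℕ) ∧ (k : ℕ) < m - i) → x k = 0) : 0 < foldQ m n i x := by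
  obtain ⟨k, hk⟩ := Function.ne_iff.mp hx
  have hk' : n - 1 ≤ (k : ℕ) ∧ (k : ℕ) < m - i := by
    by_contra hc
    exact hk (h k hc)
  have h2 : (∑ k : Fin m, if m - i ≤ (k : ℕ) then x k ^ 2 else 0) = 0 := by
    refine Finset.sum_eq_zero fun k _ => ?_
    split_ifs with hh
    · rw [h k (by omega)]; simp
    · rfl
  rw [foldQ, h2, sub_zero]
  refine Finset.sum_pos' (fun k _ => ?_) ⟨k, Finset.mem_univ _, ?_⟩
  · split_ifs <;> positivity
  · rw [if_pos hk']
    have : x k ≠ 0 := hk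
    positivity

lemma foldQ_neg (m n i : ℕ) (x : Fin m → ℝ) (hx : x ≠ 0)
    (h : ∀ k : Fin m, ¬ (m - i ≤ (k : ℕ)) → x k = 0) : foldQ m n i x < 0 := by
  obtain ⟨k, hk⟩ := Function.ne_iff.mp hx
  have hk' : m - i ≤ (k : ℕ) := by
    by_contra hc
    exact hk (h k hc)
  have h2 : (∑ k : Fin m, if n - 1 ≤ (k : ℕ) ∧ (k : ℕ) < m - i then x k ^ 2 else 0) = 0 := by
    refine Finset.sum_eq_zero fun k _ => ?_
    split_ifs with hh
    · rw [h k (by omega)]; simp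
    · rfl
  rw [foldQ, h2, zero_sub, neg_lt_zero]
  refine Finset.sum_pos' (fun k _ => ?_) ⟨k, Finset.mem_univ _, ?_⟩
  · split_ifs <;> positivity
  · rw [if_pos hk']
    have : x k ≠ 0 := hk
    positivity

lemma fold_card (m a b : ℕ) (hb : b ≤ m) :
    Fintype.card {k : Fin m // a ≤ (k : ℕ) ∧ (k : ℕ) < b} = b - a := by
  rw [Fintype.card_subtype, ← Nat.card_Ico a b, ← Finset.card_map Fin.valEmbedding]
  congr 1
  ext x
  simp only [Finset.mem_map, Finset.mem_filter, Finset.mem_univ, true_and, Fin.valEmbedding_apply,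
    Finset.mem_Ico]
  constructor
  · rintro ⟨y, hy, rfl⟩; exact hy
  · intro h; exact ⟨⟨x, by omega⟩, h, rfl⟩

/-- A dimension count. -/
lemma fold_dim (m : ℕ) (D : (Fin m → ℝ) →ₗ[ℝ] (Fin m → ℝ)) (p r : Fin m → Prop)
    [DecidablePred p] [DecidablePred r] (h : Fintype.card {k // r k} < Fintype.card {k // p k}) :
    ∃ v : Fin m → ℝ, v ≠ 0 ∧ (∀ k, ¬ p k → v k = 0) ∧ ∀ k, r k → D v k = 0 := by
  let E : ({k // p k} → ℝ) →ₗ[ℝ] (Fin m → ℝ) :=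
    { toFun := fun w k => if hk : p k then w ⟨k, hk⟩ else 0
      map_add' := by intro a b; ext k; by_cases hk : p k <;> simp [hk]
      map_smul' := by intro a b; ext k; by_cases hk : p k <;> simp [hk] }
  let L : ({k // p k} → ℝ) →ₗ[ℝ] ({k // r k} → ℝ) :=
    (LinearMap.funLeft ℝ ℝ (Subtype.val : {k // r k} → Fin m)) ∘ₗ D ∘ₗ E
  have hL : LinearMap.ker L ≠ ⊥ := LinearMap.ker_ne_bot_of_finrank_lt (by simpa using h)
  obtain ⟨w, hw, hw0⟩ := (Submodule.ne_bot_iff _).mp hL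
  refine ⟨E w, ?_, ?_, ?_⟩
  · intro h0
    apply hw0
    ext ⟨k, hk⟩
    have := congrFun h0 k
    simpa [E, hk] using this
  · intro k hk
    simp [E, hk]
  · intro k hk
    exact congrFun (LinearMap.mem_ker.mp hw) ⟨k, hk⟩

/-- Uniqueness of the index of a fold singular point, in local coordinates: if
the fold normal forms `g_i` and `g_{i'}` are related by smooth coordinate
changes `φ` (on the source) and `ψ` (on the target), each a diffeomorphism onto
an open image and fixing the origin, then `i = i'`. -/
theorem foldMap_index_unique (m n : ℕ) (hn : 1 ≤ n) (hmn : n ≤ m) (i i' : ℕ)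
    (hi : 2 * i ≤ m - n + 1) (hi' : 2 * i' ≤ m - n + 1)
    (U : Set (Fin m → ℝ)) (V : Set (Fin n → ℝ))
    (hUopen : IsOpen U) (hVopen : IsOpen V) (hU0 : (0 : Fin m → ℝ) ∈ U)
    (hV0 : (0 : Fin n → ℝ) ∈ V)
    (φ : (Fin m → ℝ) → (Fin m → ℝ)) (ψ : (Fin n → ℝ) → (Fin n → ℝ))
    (φinv : (Fin m → ℝ) → (Fin m → ℝ)) (ψinv : (Fin n → ℝ) → (Fin n → ℝ))
    -- `φ` is a diffeomorphism onto an open image: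
    (hφ : ContDiffOn ℝ (⊤ : ℕ∞) φ U) (hφinj : Set.InjOn φ U) (hφopen : IsOpen (φ '' U))
    (hφinv : ContDiffOn ℝ (⊤ : ℕ∞) φinv (φ '' U)) (hφleft : ∀ x ∈ U, φinv (φ x) = x)
    -- `ψ` is a diffeomorphism onto an open image:
    (hψ : ContDiffOn ℝ (⊤ : ℕ∞) ψ V) (hψinj : Set.InjOn ψ V) (hψopen : IsOpen (ψ '' V))
    (hψinv : ContDiffOn ℝ (⊤ : ℕ∞) ψinv (ψ '' V)) (hψleft : ∀ y ∈ V, ψinv (ψ y) = y)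
    -- both fix the origin:
    (hφ0 : φ 0 = 0) (hψ0 : ψ 0 = 0)
    -- `g_i (U) ⊆ V` and `ψ ∘ g_i = g_{i'} ∘ φ` on `U`:
    (hUV : foldMap m n hmn i '' U ⊆ V)
    (hcomm : ∀ x ∈ U, ψ (foldMap m n hmn i x) = foldMap m n hmn i' (φ x)) :
    i = i' := by
  have hUn : U ∈ nhds (0 : Fin m → ℝ) := hUopen.mem_nhds hU0
  have hφd : DifferentiableAt ℝ φ 0 := (hφ.contDiffAt hUn).differentiableAt (by simp)
  have hψd : DifferentiableAt ℝ ψ 0 :=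
    (hψ.contDiffAt (hVopen.mem_nhds hV0)).differentiableAt (by simp)
  have hφid : DifferentiableAt ℝ φinv 0 :=
    (hφinv.contDiffAt (hφopen.mem_nhds ⟨0, hU0, hφ0⟩)).differentiableAt (by simp)
  set D := fderiv ℝ φ 0 with hD
  set A := fderiv ℝ ψ 0 with hA
  have hDinj : ∀ v, D v = 0 → v = 0 := by
    intro v hv
    have h1 : HasFDerivAt (φinv ∘ φ) ((fderiv ℝ φinv 0).comp D) 0 := by
      refine HasFDerivAt.comp _ ?_ hφd.hasFDerivAt
      rw [hφ0]; exact hφid.hasFDerivAt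
    have h2 : HasFDerivAt (φinv ∘ φ) (ContinuousLinearMap.id ℝ _) 0 := by
      refine (hasFDerivAt_id _).congr_of_eventuallyEq ?_
      filter_upwards [hUn] with x hx using hφleft x hx
    have h3 := congrArg (fun T => T v) (h1.unique h2)
    simpa [hv] using h3.symm
  let l : Fin n := ⟨n - 1, by omega⟩
  have hlast : ∀ (j : ℕ) (x), foldMap m n hmn j x l = foldQ m n j x := by
    intro j x
    simp [foldMap, foldQ, l]
  have hK : ∀ v : Fin m → ℝ, (∀ k : Fin m, (k : ℕ) < n - 1 → v k = 0) → ∀ t : ℝ,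
      foldMap m n hmn i (t • v) = (t ^ 2) • (foldQ m n i v • (Pi.single l 1 : Fin n → ℝ)) := by
    intro v hv t
    ext j
    by_cases hj : j = l
    · subst hj
      rw [hlast, foldQ_smul]; simp
    · have : (j : ℕ) < n - 1 := by
        have : (j : ℕ) ≠ n - 1 := fun h => hj (Fin.ext h)
        omega
      simp [foldMap, this, hj, hv (Fin.castLE hmn j) this]
  -- limits
  have hlim1 : ∀ v, Filter.Tendsto (fun t : ℝ => t⁻¹ • φ (t • v)) (nhdsWithin 0 {0}ᶜ)
      (nhds (D v)) := by
    intro v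
    have := (hφd.hasFDerivAt.hasLineDerivAt v).tendsto_slope_zero
    simpa [hφ0] using this
  have hlim2 : ∀ w, Filter.Tendsto (fun t : ℝ => (t ^ 2)⁻¹ • ψ (t ^ 2 • w)) (nhdsWithin 0 {0}ᶜ)
      (nhds (A w)) := by
    intro w
    have := (hψd.hasFDerivAt.hasLineDerivAt w).tendsto_slope_zero
    have h2 : Filter.Tendsto (fun t : ℝ => t ^ 2) (nhdsWithin 0 {0}ᶜ) (nhdsWithin 0 {0}ᶜ) := by
      refine tendsto_nhdsWithin_iff.mpr ⟨?_, ?_⟩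
      · refine Filter.Tendsto.mono_left ?_ nhdsWithin_le_nhds
        have : Continuous fun t : ℝ => t ^ 2 := by fun_prop
        simpa using this.tendsto 0
      · filter_upwards [self_mem_nhdsWithin] with t ht
        simpa using ht
    simpa [hψ0, Function.comp_def] using this.comp h2
  have hev : ∀ v : Fin m → ℝ, (∀ k : Fin m, (k : ℕ) < n - 1 → v k = 0) →
      ∀ᶠ t : ℝ in nhdsWithin 0 {0}ᶜ, t ≠ 0 ∧
        ψ ((t ^ 2) • (foldQ m n i v • (Pi.single l 1 : Fin n → ℝ)))
          = foldMap m n hmn i' (φ (t • v)) := by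
    intro v hv
    have hc : Filter.Tendsto (fun t : ℝ => t • v) (nhdsWithin 0 {0}ᶜ) (nhds 0) := by
      refine Filter.Tendsto.mono_left ?_ nhdsWithin_le_nhds
      have : Continuous fun t : ℝ => t • v := by fun_prop
      simpa using this.tendsto 0
    filter_upwards [self_mem_nhdsWithin, hc hUn] with t ht htU
    refine ⟨ht, ?_⟩
    rw [← hK v hv t]
    exact hcomm _ htU
  have hDK : ∀ v : Fin m → ℝ, (∀ k : Fin m, (k : ℕ) < n - 1 → v k = 0) →
      ∀ k : Fin m, (k : ℕ) < n - 1 → D v k = 0 := by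
    intro v hv k hk
    have h1 := (tendsto_pi_nhds.mp (hlim1 v)) k
    let j : Fin n := ⟨k, by omega⟩
    have h2 := (tendsto_pi_nhds.mp
      (hlim2 (foldQ m n i v • (Pi.single l 1 : Fin n → ℝ)))) j
    have h3 : Filter.Tendsto (fun t : ℝ => t) (nhdsWithin 0 {0}ᶜ) (nhds 0) :=
      Filter.Tendsto.mono_left Filter.tendsto_id nhdsWithin_le_nhds
    have h4 := h3.mul h2
    rw [zero_mul] at h4
    refine tendsto_nhds_unique h1 (h4.congr' ?_)
    filter_upwards [hev v hv] with t ht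
    have h5 := congrFun ht.2 j
    have h6 : foldMap m n hmn i' (φ (t • v)) j = φ (t • v) k := by
      have : Fin.castLE hmn j = k := Fin.ext rfl
      simp [foldMap, j, hk]
    rw [Pi.smul_apply, Pi.smul_apply, h5, h6, smul_eq_mul, smul_eq_mul]
    have := ht.1
    field_simp
  have hform : ∀ v : Fin m → ℝ, (∀ k : Fin m, (k : ℕ) < n - 1 → v k = 0) →
      foldQ m n i' (D v) = foldQ m n i v * A (Pi.single l 1) l := by
    intro v hv
    have h1 := ((foldQ_continuous m n i').tendsto (D v)).comp (hlim1 v)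
    have h2 := (tendsto_pi_nhds.mp
      (hlim2 (foldQ m n i v • (Pi.single l 1 : Fin n → ℝ)))) l
    have h3 : A (foldQ m n i v • (Pi.single l 1 : Fin n → ℝ)) l
        = foldQ m n i v * A (Pi.single l 1) l := by
      rw [map_smul]; rfl
    rw [← h3]
    refine tendsto_nhds_unique h1 (h2.congr' ?_)
    filter_upwards [hev v hv] with t ht
    rw [Pi.smul_apply, ht.2, hlast, Function.comp_apply, foldQ_smul, smul_eq_mul, inv_pow]
  -- dimension counts
  set a := A (Pi.single l 1) l
  have cP : ∀ j, Fintype.card {k : Fin m // n - 1 ≤ (k : ℕ) ∧ (k : ℕ) < m - j} = m - j - (n - 1) :=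
    fun j => fold_card m (n - 1) (m - j) (by omega)
  have cN : ∀ j, Fintype.card {k : Fin m // m - j ≤ (k : ℕ) ∧ (k : ℕ) < m} = m - (m - j) :=
    fun j => fold_card m (m - j) m le_rfl
  rcases le_or_gt a 0 with ha | ha
  · by_contra hne
    obtain ⟨v, hv0, hv, hDv⟩ := fold_dim m D
      (fun k => n - 1 ≤ (k : ℕ) ∧ (k : ℕ) < m - i) (fun k => m - i' ≤ (k : ℕ) ∧ (k : ℕ) < m)
      (by rw [cP, cN]; omega)
    have hvK : ∀ k : Fin m, (k : ℕ) < n - 1 → v k = 0 := fun k hk => hv k (by omega)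
    have h1 := hform v hvK
    have h2 := foldQ_pos m n i v hv0 hv
    have h3 := foldQ_pos m n i' (D v) (fun h => hv0 (hDinj v h)) (fun k hk => by
      by_cases h : (k : ℕ) < n - 1
      · exact hDK v hvK k h
      · exact hDv k (by omega))
    nlinarith [mul_nonneg h2.le (neg_nonneg.mpr ha)]
  · refine le_antisymm ?_ ?_
    · by_contra hne
      obtain ⟨v, hv0, hv, hDv⟩ := fold_dim m D
        (fun k => m - i ≤ (k : ℕ) ∧ (k : ℕ) < m) (fun k => m - i' ≤ (k : ℕ) ∧ (k : ℕ) < m)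
        (by rw [cN, cN]; omega)
      have hvK : ∀ k : Fin m, (k : ℕ) < n - 1 → v k = 0 := fun k hk => hv k (by omega)
      have h1 := hform v hvK
      have h2 := foldQ_neg m n i v hv0 (fun k hk => hv k (by omega))
      have h3 := foldQ_pos m n i' (D v) (fun h => hv0 (hDinj v h)) (fun k hk => by
        by_cases h : (k : ℕ) < n - 1
        · exact hDK v hvK k h
        · exact hDv k (by omega))
      nlinarith [mul_pos (neg_pos.mpr h2) ha]
    · by_contra hne
      obtain ⟨v, hv0, hv, hDv⟩ := fold_dim m D
        (fun k => n - 1 ≤ (k : ℕ) ∧ (k : ℕ) < m - i)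
        (fun k => n - 1 ≤ (k : ℕ) ∧ (k : ℕ) < m - i')
        (by rw [cP, cP]; omega)
      have hvK : ∀ k : Fin m, (k : ℕ) < n - 1 → v k = 0 := fun k hk => hv k (by omega)
      have h1 := hform v hvK
      have h2 := foldQ_pos m n i v hv0 hv
      have h3 := foldQ_neg m n i' (D v) (fun h => hv0 (hDinj v h)) (fun k hk => by
        by_cases h : (k : ℕ) < n - 1
        · exact hDK v hvK k h
        · exact hDv k (by omega))
      nlinarith [mul_pos h2 ha]
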